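/- Let A be a complete finitely ambiguous NBW and let w ∈ L(A). Then there exists a separating level d ≥ 1 such that for every accepting initial ω-branch γ of the run DAG G of A over w and every level l > d, the vertex γ(l) has exactly one predecessor in G, i.e., there is exactly one vertex u of G with an edge from u to γ(l). -/

import Mathlib

open scoped Classical

/-- A nondeterministic Büchi automaton on ω-words with states `Q` over alphabet `σ`. -/
structure NBW (σ : Type) (Q : Type) where
  init : Set Q
  trans : Q → σ → Set Q
  acc : Set Q

namespace NBW

variable {σ Q : Type}

/-- `ρ` is a run of `A` on the ω-word `w`. -/
def IsRun (A : NBW σ Q) (w : ℕ → σ) (ρ : ℕ → Q) : Prop :=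
  ρ 0 ∈ A.init ∧ ∀ i, ρ (i + 1) ∈ A.trans (ρ i) (w i)

/-- `ρ` is an accepting run of `A` on `w`: it visits `A.acc` infinitely often. -/
def IsAccRun (A : NBW σ Q) (w : ℕ → σ) (ρ : ℕ → Q) : Prop :=
  A.IsRun w ρ ∧ ∀ n, ∃ m, n ≤ m ∧ ρ m ∈ A.acc

/-- The ω-language accepted by `A`. -/
def Lang (A : NBW σ Q) : Set (ℕ → σ) := {w | ∃ ρ, A.IsAccRun w ρ}

/-- `A` is complete: every state has a successor on every letter. -/
def Complete (A : NBW σ Q) : Prop := ∀ q a, (A.trans q a).Nonempty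

/-- `A` is finitely ambiguous: every accepted word has finitely many accepting runs. -/
def FinitelyAmbiguous (A : NBW σ Q) : Prop :=
  ∀ w ∈ A.Lang, {ρ | A.IsAccRun w ρ}.Finite

/-- `A` is limit deterministic with partition `(QN, QD)`. -/
def LimitDetPart (A : NBW σ Q) (QN QD : Set Q) : Prop :=
  Disjoint QN QD ∧ QN ∪ QD = Set.univ ∧ A.acc ⊆ QD ∧
    ∀ q ∈ QD, ∀ a, ∃ q' ∈ QD, A.trans q a = {q'}

/-- `A` is limit deterministic (for some partition). -/
def LimitDet (A : NBW σ Q) : Prop := ∃ QN QD, A.LimitDetPart QN QD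

end NBW

namespace NBW

variable {σ Q : Type}

/-- The set of successors of the set `S` under letter `b`. -/
def dSet (A : NBW σ Q) (S : Set Q) (b : σ) : Set Q := ⋃ q ∈ S, A.trans q b

/-- The set of states occurring at level `ℓ` of the run DAG of `A` over `w`. -/
def levelSet (A : NBW σ Q) (w : ℕ → σ) : ℕ → Set Q
  | 0 => A.init
  | ℓ + 1 => A.dSet (levelSet A w ℓ) (w ℓ)

/-- Edge of the run DAG `G` of `A` over `w` from vertex `(q, ℓ)` to vertex `(q', ℓ+1)`. -/
def GEdge (A : NBW σ Q) (w : ℕ → σ) (q : Q) (ℓ : ℕ) (q' : Q) : Prop :=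
  q ∈ A.levelSet w ℓ ∧ q' ∈ A.trans q (w ℓ)

/-- Edge of the reduced run DAG `Ḡ` of `A` over `w` (wrt the fixed enumeration given
by the linear order on `Q`) from vertex `(q, ℓ)` to vertex `(q', ℓ+1)`:
`q` is the minimal state of level `ℓ` having `q'` as a successor. -/
def RedEdge (A : NBW σ Q) [LinearOrder Q] (w : ℕ → σ) (q : Q) (ℓ : ℕ) (q' : Q) : Prop :=
  q ∈ A.levelSet w ℓ ∧ q' ∈ A.trans q (w ℓ) ∧
    ∀ p ∈ A.levelSet w ℓ, q' ∈ A.trans p (w ℓ) → q ≤ p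

/-- `γ` is an initial ω-branch of the level-indexed DAG with edge relation `E`:
`γ ℓ` is the state of the branch vertex at level `ℓ`. -/
def IsInitOmegaBranch (A : NBW σ Q) (E : Q → ℕ → Q → Prop) (γ : ℕ → Q) : Prop :=
  γ 0 ∈ A.init ∧ ∀ ℓ, E (γ ℓ) ℓ (γ (ℓ + 1))

/-- The branch `γ` is accepting: it visits `F`-vertices infinitely often. -/
def IsAcceptingBranch (A : NBW σ Q) (γ : ℕ → Q) : Prop :=
  ∀ n, ∃ m, n ≤ m ∧ γ m ∈ A.acc

/-- There is an infinite branch from vertex `(q, ℓ)` inside the sub-DAG with vertex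
predicate `P` and edge relation `E`. -/
def SubInfBranch (P : Q → ℕ → Prop) (E : Q → ℕ → Q → Prop) (q : Q) (ℓ : ℕ) : Prop :=
  ∃ γ : ℕ → Q, γ 0 = q ∧ (∀ i, P (γ i) (ℓ + i)) ∧ ∀ i, E (γ i) (ℓ + i) (γ (i + 1))

/-- Vertex `(q', ℓ')` is reachable from vertex `(q, ℓ)` inside the sub-DAG with
vertex predicate `P` and edge relation `E`. -/
def SubReach (P : Q → ℕ → Prop) (E : Q → ℕ → Q → Prop)
    (q : Q) (ℓ : ℕ) (q' : Q) (ℓ' : ℕ) : Prop :=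
  ∃ n, ∃ γ : ℕ → Q, γ 0 = q ∧ γ n = q' ∧ ℓ' = ℓ + n ∧
    (∀ i ≤ n, P (γ i) (ℓ + i)) ∧ ∀ i < n, E (γ i) (ℓ + i) (γ (i + 1))

/-- Vertex `(q, ℓ)` is `F`-free in the sub-DAG with vertex predicate `P` and edge
relation `E`: it is not finite and no `F`-vertex is reachable from it. -/
def FFreeVtx (A : NBW σ Q) (P : Q → ℕ → Prop) (E : Q → ℕ → Q → Prop)
    (q : Q) (ℓ : ℕ) : Prop :=
  SubInfBranch P E q ℓ ∧ ∀ q' ℓ', SubReach P E q ℓ q' ℓ' → q' ∉ A.acc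

/-- The pruning sequence of the DAG with vertex predicate `P0` and edge relation `E`:
odd steps remove the finite vertices, even steps remove the `F`-free vertices,
everything being evaluated in the current graph. -/
def pruneSeq (A : NBW σ Q) (E : Q → ℕ → Q → Prop) (P0 : Q → ℕ → Prop) :
    ℕ → Q → ℕ → Prop
  | 0 => P0
  | i + 1 =>
    if i % 2 = 0 then
      fun q ℓ => pruneSeq A E P0 i q ℓ ∧ SubInfBranch (pruneSeq A E P0 i) E q ℓ
    else
      fun q ℓ => pruneSeq A E P0 i q ℓ ∧ ¬ A.FFreeVtx (pruneSeq A E P0 i) E q ℓ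

end NBW

theorem NBW.exists_prefix {σ Q : Type} (A : NBW σ Q) (w : ℕ → σ) :
    ∀ (n : ℕ) (u : Q), u ∈ A.levelSet w n →
      ∃ ρ : ℕ → Q, ρ 0 ∈ A.init ∧ ρ n = u ∧ ∀ i < n, ρ (i + 1) ∈ A.trans (ρ i) (w i) := by
  intro n
  induction n with
  | zero => intro u hu; exact ⟨fun _ => u, hu, rfl, by simp⟩
  | succ n ih =>
    intro u hu
    simp only [NBW.levelSet, NBW.dSet, Set.mem_iUnion] at hu
    obtain ⟨q, hq, hqu⟩ := hu
    obtain ⟨ρ, h0, hn, hs⟩ := ih q hq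
    refine ⟨fun i => if i ≤ n then ρ i else u, by simpa using h0, by simp, ?_⟩
    intro i hi
    by_cases h : i = n
    · subst h; simpa [hn] using hqu
    · have h1 : i + 1 ≤ n := by omega
      have h2 : i ≤ n := by omega
      simpa [h1, h2] using hs i (by omega)

theorem NBW.exists_merge {σ Q : Type} (A : NBW σ Q) (w : ℕ → σ) (γ : ℕ → Q)
    (hγ : A.IsAccRun w γ) (n : ℕ) (u : Q) (hu : u ∈ A.levelSet w n)
    (hs : γ (n + 1) ∈ A.trans u (w n)) :
    ∃ ρ, A.IsAccRun w ρ ∧ ρ n = u ∧ ∀ i, n < i → ρ i = γ i := by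
  obtain ⟨ρ, h0, hn, hρ⟩ := A.exists_prefix w n u hu
  refine ⟨fun i => if i ≤ n then ρ i else γ i, ⟨⟨by simpa using h0, ?_⟩, ?_⟩, by simpa using hn, ?_⟩
  · intro i
    rcases lt_trichotomy i n with h | h | h
    · have h1 : i + 1 ≤ n := by omega
      have h2 : i ≤ n := by omega
      simpa [h1, h2] using hρ i h
    · subst h; simpa [hn] using hs
    · have h1 : ¬ i + 1 ≤ n := by omega
      have h2 : ¬ i ≤ n := by omega
      simpa only [h1, h2, if_false] using hγ.1.2 i
  · intro m
    obtain ⟨k, hk, hk'⟩ := hγ.2 (m + n + 1)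
    refine ⟨k, by omega, ?_⟩
    have h1 : ¬ k ≤ n := by omega
    simpa only [h1, if_false] using hk'
  · intro i hi
    have h1 : ¬ i ≤ n := by omega
    simp [h1]

/-- Separating level: for a complete FANBW `A` and `w ∈ L(A)`, there is a level
`d ≥ 1` such that every vertex of an accepting initial ω-branch of the run DAG
at a level `l > d` has exactly one predecessor. -/
theorem NBW.separating_level (σ Q : Type) [Fintype σ] [Nonempty σ] [Fintype Q]
    (A : NBW σ Q) (hc : A.Complete) (hfa : A.FinitelyAmbiguous)
    (w : ℕ → σ) (hw : w ∈ A.Lang) :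
    ∃ d : ℕ, 1 ≤ d ∧
      ∀ γ : ℕ → Q, A.IsInitOmegaBranch (A.GEdge w) γ → A.IsAcceptingBranch γ →
        ∀ l, d < l →
          ∃! u : Q, u ∈ A.levelSet w (l - 1) ∧ γ l ∈ A.trans u (w (l - 1)) := by
  have hfin := hfa w hw
  set S := {ρ | A.IsAccRun w ρ} with hS
  have hB : (⋃ p ∈ S ×ˢ S, {n : ℕ | p.1 n ≠ p.2 n ∧ ∀ i, n < i → p.1 i = p.2 i}).Finite := by
    refine (hfin.prod hfin).biUnion fun p _ => Set.Subsingleton.finite ?_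
    rintro a ⟨ha, ha'⟩ b ⟨hb, hb'⟩
    rcases lt_trichotomy a b with h | h | h
    · exact absurd (ha' b h) hb
    · exact h
    · exact absurd (hb' a h) ha
  obtain ⟨d, hd⟩ := hB.bddAbove
  refine ⟨d + 1, by omega, ?_⟩
  intro γ hγ hacc l hl
  obtain ⟨n, rfl⟩ : ∃ n, l = n + 1 := ⟨l - 1, by omega⟩
  rw [Nat.add_sub_cancel]
  have hrun : A.IsAccRun w γ := ⟨⟨hγ.1, fun i => (hγ.2 i).2⟩, hacc⟩
  refine ⟨γ n, hγ.2 n, ?_⟩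
  rintro u ⟨hu, hu'⟩
  by_contra hne
  obtain ⟨ρ, hρ, hρn, hρi⟩ := A.exists_merge w γ hrun n u hu hu'
  have hmem : n ≤ d := hd (Set.mem_biUnion (x := (ρ, γ)) (Set.mk_mem_prod hρ hrun)
    ⟨by simpa [hρn] using hne, hρi⟩)
  omega
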